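/- Let n ≥ 2 and s ∈ (0,1). If H ⊆ ℝⁿ is an open half-space and Z ⊆ H is a bounded measurable set, then I_s(Z, H∖Z) ≥ I_s(Z, ℝⁿ∖H). -/

import Mathlib

open MeasureTheory Filter Metric
open scoped ENNReal NNReal Topology RealInnerProductSpace

/-- Fractional interaction energy `I_s(E,F) = ∫_E ∫_F |x-y|^{-(n+s)} dy dx`. -/
noncomputable def interFrac (n : ℕ) (s : ℝ) (E F : Set (EuclideanSpace ℝ (Fin n))) : ℝ≥0∞ :=
  ∫⁻ x in E, ∫⁻ y in F, ENNReal.ofReal (‖x - y‖ ^ (-((n : ℝ) + s)))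

/-- `H` is an open half-space of `ℝⁿ`. -/
def IsOpenHalfSpace {n : ℕ} (H : Set (EuclideanSpace ℝ (Fin n))) : Prop :=
  ∃ v : EuclideanSpace ℝ (Fin n), ‖v‖ = 1 ∧ ∃ c : ℝ, H = {x | ⟪x, v⟫ < c}

section HalfSpace

variable {E : Type*} [NormedAddCommGroup E] [InnerProductSpace ℝ E] [FiniteDimensional ℝ E]
  [MeasurableSpace E] [BorelSpace E]

/-- The point reflection through `x` preserves an even kernel centred at `x`. -/
lemma setLIntegral_reflection {K : E → ℝ≥0∞} (hK : ∀ z, K (-z) = K z) (x : E)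
    {S T : Set E} (hS : MeasurableSet S) (hT : MeasurableSet T)
    (hST : ∀ y, x + x - y ∈ S ↔ y ∈ T) :
    ∫⁻ y in S, K (x - y) = ∫⁻ y in T, K (x - y) := by
  rw [← lintegral_indicator hS, ← lintegral_indicator hT,
    ← lintegral_sub_left_eq_self _ (x + x)]
  refine lintegral_congr fun y => ?_
  have h : x - (x + x - y) = -(x - y) := by abel
  by_cases hy : y ∈ T
  · rw [Set.indicator_of_mem hy, Set.indicator_of_mem ((hST y).2 hy), h, hK]
  · rw [Set.indicator_of_notMem hy, Set.indicator_of_notMem (mt (hST y).1 hy)]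

/-- Splitting a set according to the position relative to the hyperplane through `x`. -/
lemma setLIntegral_split_hyperplane (v x : E) (f : E → ℝ≥0∞) {S : Set E} (hS : MeasurableSet S) :
    ∫⁻ y in S, f y = (∫⁻ y in S ∩ {y | ⟪y, v⟫ < ⟪x, v⟫}, f y)
      + ((∫⁻ y in S ∩ {y | ⟪y, v⟫ = ⟪x, v⟫}, f y)
        + ∫⁻ y in S ∩ {y | ⟪x, v⟫ < ⟪y, v⟫}, f y) := by
  have hm : Measurable fun y : E => ⟪y, v⟫ := by fun_prop
  have hlt : MeasurableSet {y : E | ⟪y, v⟫ < ⟪x, v⟫} := measurableSet_lt hm measurable_const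
  have heq : MeasurableSet {y : E | ⟪y, v⟫ = ⟪x, v⟫} := measurableSet_eq_fun hm measurable_const
  have hgt : MeasurableSet {y : E | ⟪x, v⟫ < ⟪y, v⟫} := measurableSet_lt measurable_const hm
  rw [← lintegral_union (hS.inter hgt), ← lintegral_union ((hS.inter heq).union (hS.inter hgt))]
  · congr 2
    ext y
    simp only [Set.mem_union, Set.mem_inter_iff, Set.mem_ofPred_eq]
    have := lt_trichotomy ⟪y, v⟫ ⟪x, v⟫
    tauto
  · rw [Set.disjoint_left]
    rintro y ⟨-, hy⟩ (⟨-, hy'⟩ | ⟨-, hy'⟩) <;> simp only [Set.mem_ofPred_eq] at hy hy' <;> linarith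
  · rw [Set.disjoint_left]
    rintro y ⟨-, hy⟩ ⟨-, hy'⟩
    simp only [Set.mem_ofPred_eq] at hy hy'
    linarith

/-- Interactions within `Z` with points above and with points below agree. -/
lemma lintegral_lintegral_below_eq_above {K : E → ℝ≥0∞} (hKm : Measurable K)
    (hK : ∀ z, K (-z) = K z) (v : E) (Z : Set E) :
    ∫⁻ x in Z, ∫⁻ y in Z ∩ {y | ⟪y, v⟫ < ⟪x, v⟫}, K (x - y)
      = ∫⁻ x in Z, ∫⁻ y in Z ∩ {y | ⟪x, v⟫ < ⟪y, v⟫}, K (x - y) := by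
  have hm : Measurable fun y : E => ⟪y, v⟫ := by fun_prop
  have hlt (x : E) : MeasurableSet {y : E | ⟪y, v⟫ < ⟪x, v⟫} := measurableSet_lt hm measurable_const
  have hgt (x : E) : MeasurableSet {y : E | ⟪x, v⟫ < ⟪y, v⟫} := measurableSet_lt measurable_const hm
  have h₁ (x : E) : ∫⁻ y in Z ∩ {y | ⟪y, v⟫ < ⟪x, v⟫}, K (x - y)
      = ∫⁻ y in Z, {y | ⟪y, v⟫ < ⟪x, v⟫}.indicator (fun y => K (x - y)) y := by
    rw [setLIntegral_indicator (hlt x), Set.inter_comm]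
  have h₂ (x : E) : ∫⁻ y in Z ∩ {y | ⟪x, v⟫ < ⟪y, v⟫}, K (x - y)
      = ∫⁻ y in Z, {y | ⟪x, v⟫ < ⟪y, v⟫}.indicator (fun y => K (x - y)) y := by
    rw [setLIntegral_indicator (hgt x), Set.inter_comm]
  simp_rw [h₁, h₂]
  rw [lintegral_lintegral_swap]
  · refine lintegral_congr fun x => lintegral_congr fun y => ?_
    simp only [Set.indicator_apply, Set.mem_ofPred_eq]
    rw [← hK (y - x), neg_sub]
  · have hset : MeasurableSet {p : E × E | ⟪p.2, v⟫ < ⟪p.1, v⟫} :=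
      measurableSet_lt (hm.comp measurable_snd) (hm.comp measurable_fst)
    exact ((hKm.comp (measurable_fst.sub measurable_snd)).indicator hset).aemeasurable

/-- Half-spaces are local minimizers of the perimeter of an integrable even kernel. -/
lemma lintegral_compl_halfSpace_le_of_ne_top {K : E → ℝ≥0∞} (hKm : Measurable K)
    (hK : ∀ z, K (-z) = K z) (hKint : ∫⁻ z, K z ≠ ∞) (v : E) (c : ℝ) {Z : Set E}
    (hZ : MeasurableSet Z) (hZtop : volume Z ≠ ∞) (hZH : Z ⊆ {x | ⟪x, v⟫ < c}) :
    ∫⁻ x in Z, ∫⁻ y in {y | ⟪y, v⟫ < c}ᶜ, K (x - y)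
      ≤ ∫⁻ x in Z, ∫⁻ y in {y | ⟪y, v⟫ < c} \ Z, K (x - y) := by
  set H : Set E := {x | ⟪x, v⟫ < c} with hHdef
  have hm : Measurable fun y : E => ⟪y, v⟫ := by fun_prop
  have hH : MeasurableSet H := measurableSet_lt hm measurable_const
  have hKxy : Measurable fun p : E × E => K (p.1 - p.2) :=
    hKm.comp (measurable_fst.sub measurable_snd)
  have hmeas (S : Set E) : Measurable fun x => ∫⁻ y in S, K (x - y) :=
    hKxy.lintegral_prod_right'
  have hmeas' (R : E → E → Prop) (hR : MeasurableSet {p : E × E | R p.1 p.2}) :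
      Measurable fun x => ∫⁻ y in Z ∩ {y | R x y}, K (x - y) := by
    have h (x : E) : ∫⁻ y in Z ∩ {y | R x y}, K (x - y)
        = ∫⁻ y in Z, {p : E × E | R p.1 p.2}.indicator (fun p => K (p.1 - p.2)) (x, y) := by
      have hRx : MeasurableSet {y | R x y} := hR.preimage measurable_prodMk_left
      rw [Set.inter_comm, ← setLIntegral_indicator hRx]
      rfl
    simp_rw [h]
    exact (hKxy.indicator hR).lintegral_prod_right'
  have hlt : Measurable fun x => ∫⁻ y in Z ∩ {y | ⟪y, v⟫ < ⟪x, v⟫}, K (x - y) :=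
    hmeas' (fun x y => ⟪y, v⟫ < ⟪x, v⟫)
      (measurableSet_lt (hm.comp measurable_snd) (hm.comp measurable_fst))
  have hgt : Measurable fun x => ∫⁻ y in Z ∩ {y | ⟪x, v⟫ < ⟪y, v⟫}, K (x - y) :=
    hmeas' (fun x y => ⟪x, v⟫ < ⟪y, v⟫)
      (measurableSet_lt (hm.comp measurable_fst) (hm.comp measurable_snd))
  have heq : Measurable fun x => ∫⁻ y in Z ∩ {y | ⟪y, v⟫ = ⟪x, v⟫}, K (x - y) :=
    hmeas' (fun x y => ⟪y, v⟫ = ⟪x, v⟫)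
      (measurableSet_eq_fun (hm.comp measurable_snd) (hm.comp measurable_fst))
  have hfin : ∫⁻ x in Z, ∫⁻ y in Z, K (x - y) ≠ ∞ := by
    refine ne_top_of_le_ne_top (ENNReal.mul_ne_top hKint hZtop) ?_
    rw [← setLIntegral_const]
    refine lintegral_mono fun x => (setLIntegral_le_lintegral Z _).trans ?_
    rw [lintegral_sub_left_eq_self]
  have hpt (x : E) (hx : x ∈ Z) :
      (∫⁻ y in Hᶜ, K (x - y)) + ((∫⁻ y in Z ∩ {y | ⟪y, v⟫ = ⟪x, v⟫}, K (x - y))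
        + ((∫⁻ y in Z ∩ {y | ⟪x, v⟫ < ⟪y, v⟫}, K (x - y))
          + ∫⁻ y in Z ∩ {y | ⟪x, v⟫ < ⟪y, v⟫}, K (x - y))) ≤ ∫⁻ y in H, K (x - y) := by
    have hxc : ⟪x, v⟫ < c := hZH hx
    set F : Set E := {y | ⟪y, v⟫ ≤ ⟪x, v⟫ + ⟪x, v⟫ - c}
    have hF : MeasurableSet F := measurableSet_le hm measurable_const
    have hrefl : ∫⁻ y in Hᶜ, K (x - y) = ∫⁻ y in F, K (x - y) := by
      refine setLIntegral_reflection hK x hH.compl hF fun y => ?_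
      simp only [hHdef, F, Set.mem_compl_iff, Set.mem_ofPred_eq, inner_sub_left, inner_add_left,
        not_lt]
      constructor <;> intro h <;> linarith
    have hA : MeasurableSet ((H \ F) ∩ {y | ⟪y, v⟫ < ⟪x, v⟫}) :=
      (hH.diff hF).inter (measurableSet_lt hm measurable_const)
    have hB : MeasurableSet ((H \ F) ∩ {y | ⟪x, v⟫ < ⟪y, v⟫}) :=
      (hH.diff hF).inter (measurableSet_lt measurable_const hm)
    have hmid : ∫⁻ y in (H \ F) ∩ {y | ⟪y, v⟫ < ⟪x, v⟫}, K (x - y)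
        = ∫⁻ y in (H \ F) ∩ {y | ⟪x, v⟫ < ⟪y, v⟫}, K (x - y) := by
      refine setLIntegral_reflection hK x hA hB fun y => ?_
      simp only [hHdef, F, Set.mem_inter_iff, Set.mem_sdiff, Set.mem_ofPred_eq, inner_sub_left,
        inner_add_left, not_le]
      constructor <;> rintro ⟨⟨h₁, h₂⟩, h₃⟩ <;> refine ⟨⟨?_, ?_⟩, ?_⟩ <;> linarith
    have hFH : F ⊆ H := fun y hy => by
      simp only [hHdef, F, Set.mem_ofPred_eq] at hy ⊢
      linarith
    have hsplit : ∫⁻ y in H, K (x - y)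
        = (∫⁻ y in F, K (x - y)) + ∫⁻ y in H \ F, K (x - y) := by
      rw [← lintegral_inter_add_sdiff (fun y => K (x - y)) H hF, Set.inter_eq_right.2 hFH]
    have habove : Z ∩ {y | ⟪x, v⟫ < ⟪y, v⟫} ⊆ (H \ F) ∩ {y | ⟪x, v⟫ < ⟪y, v⟫} := by
      rintro y ⟨hy, hxy⟩
      refine ⟨⟨hZH hy, ?_⟩, hxy⟩
      simp only [F, Set.mem_ofPred_eq, not_le] at hxy ⊢
      linarith
    have hlevel : Z ∩ {y | ⟪y, v⟫ = ⟪x, v⟫} ⊆ (H \ F) ∩ {y | ⟪y, v⟫ = ⟪x, v⟫} := by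
      rintro y ⟨hy, hxy⟩
      refine ⟨⟨hZH hy, ?_⟩, hxy⟩
      simp only [F, Set.mem_ofPred_eq, not_le] at hxy ⊢
      linarith
    rw [hsplit, hrefl, setLIntegral_split_hyperplane v x _ (hH.diff hF), hmid,
      add_left_comm (∫⁻ y in (H \ F) ∩ {y | ⟪x, v⟫ < ⟪y, v⟫}, K (x - y))]
    exact add_le_add_right (add_le_add (lintegral_mono_set hlevel)
      (add_le_add (lintegral_mono_set habove) (lintegral_mono_set habove))) _
  have hZZ : ∫⁻ x in Z, ∫⁻ y in Z, K (x - y)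
      = (∫⁻ x in Z, ∫⁻ y in Z ∩ {y | ⟪y, v⟫ = ⟪x, v⟫}, K (x - y))
        + ((∫⁻ x in Z, ∫⁻ y in Z ∩ {y | ⟪x, v⟫ < ⟪y, v⟫}, K (x - y))
          + ∫⁻ x in Z, ∫⁻ y in Z ∩ {y | ⟪x, v⟫ < ⟪y, v⟫}, K (x - y)) := by
    simp_rw [fun x => setLIntegral_split_hyperplane v x (fun y => K (x - y)) hZ]
    rw [lintegral_add_left hlt, lintegral_add_left heq,
      lintegral_lintegral_below_eq_above hKm hK v Z, add_left_comm]
  refine ENNReal.le_of_add_le_add_right hfin ?_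
  calc (∫⁻ x in Z, ∫⁻ y in Hᶜ, K (x - y)) + ∫⁻ x in Z, ∫⁻ y in Z, K (x - y)
      ≤ ∫⁻ x in Z, ∫⁻ y in H, K (x - y) := by
        rw [hZZ, ← lintegral_add_left hgt, ← lintegral_add_left heq,
          ← lintegral_add_left (hmeas _)]
        exact setLIntegral_mono (hmeas _) hpt
    _ = (∫⁻ x in Z, ∫⁻ y in H \ Z, K (x - y)) + ∫⁻ x in Z, ∫⁻ y in Z, K (x - y) := by
        rw [← lintegral_add_left (hmeas _)]
        refine lintegral_congr fun x => ?_
        rw [← lintegral_inter_add_sdiff (fun y => K (x - y)) H hZ, Set.inter_eq_right.2 hZH,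
          add_comm]

/-- Half-spaces are local minimizers of the perimeter of an even kernel. -/
lemma lintegral_compl_halfSpace_le {K : E → ℝ≥0∞} (hKm : Measurable K)
    (hK : ∀ z, K (-z) = K z) (v : E) (c : ℝ) {Z : Set E}
    (hZ : MeasurableSet Z) (hZtop : volume Z ≠ ∞) (hZH : Z ⊆ {x | ⟪x, v⟫ < c}) :
    ∫⁻ x in Z, ∫⁻ y in {y | ⟪y, v⟫ < c}ᶜ, K (x - y)
      ≤ ∫⁻ x in Z, ∫⁻ y in {y | ⟪y, v⟫ < c} \ Z, K (x - y) := by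
  let T (k : ℕ) : E → ℝ≥0∞ := (closedBall 0 (k : ℝ)).indicator fun z => min (K z) k
  have hTm (k : ℕ) : Measurable (T k) :=
    (hKm.min measurable_const).indicator measurableSet_closedBall
  have hTeven (k : ℕ) (z : E) : T k (-z) = T k z := by
    classical simp only [T, Set.indicator_apply, mem_closedBall_zero_iff, norm_neg, hK]
  have hTmono : Monotone T := fun i j hij z => by
    refine (Set.indicator_le_indicator_of_subset (closedBall_subset_closedBall ?_)
      (fun _ => zero_le) z).trans (Set.indicator_le_indicator ?_)
    · exact_mod_cast hij
    · gcongr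
  have hTint (k : ℕ) : ∫⁻ z, T k z ≠ ∞ := by
    rw [lintegral_indicator measurableSet_closedBall]
    refine ne_top_of_le_ne_top (ENNReal.mul_ne_top (ENNReal.natCast_ne_top k)
      (measure_closedBall_lt_top (μ := volume) (x := (0 : E)) (r := k)).ne) ?_
    rw [← setLIntegral_const]
    exact lintegral_mono fun z => min_le_right _ _
  have hTle (k : ℕ) (z : E) : T k z ≤ K z :=
    (Set.indicator_le_self' (fun _ _ => zero_le) z).trans (min_le_left _ _)
  have hTsup (z : E) : K z = ⨆ k, T k z := by
    refine le_antisymm (le_of_forall_lt fun a ha => ?_) (iSup_le fun k => hTle k z)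
    obtain ⟨i, hi⟩ := ENNReal.exists_nat_gt ha.ne_top
    obtain ⟨j, hj⟩ := exists_nat_ge ‖z‖
    have hmem : z ∈ closedBall (0 : E) ((max i j : ℕ) : ℝ) := by
      rw [mem_closedBall_zero_iff]
      exact hj.trans (by exact_mod_cast le_max_right i j)
    refine lt_of_lt_of_le ?_ (le_iSup _ (max i j))
    simp only [T, Set.indicator_of_mem hmem]
    exact lt_min ha (hi.trans_le (by exact_mod_cast le_max_left i j))
  have hmeas (k : ℕ) (S : Set E) : Measurable fun x => ∫⁻ y in S, T k (x - y) :=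
    ((hTm k).comp (measurable_fst.sub measurable_snd)).lintegral_prod_right'
  have hsup (S : Set E) : ∫⁻ x in Z, ∫⁻ y in S, K (x - y)
      = ⨆ k, ∫⁻ x in Z, ∫⁻ y in S, T k (x - y) := by
    rw [← lintegral_iSup (fun k => hmeas k S)
      fun i j hij x => lintegral_mono fun y => hTmono hij (x - y)]
    refine lintegral_congr fun x => ?_
    rw [← lintegral_iSup (f := fun k y => T k (x - y))
      (fun k => (hTm k).comp (measurable_const.sub measurable_id))
      fun i j hij y => hTmono hij (x - y)]
    exact lintegral_congr fun y => hTsup (x - y)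
  rw [hsup]
  refine iSup_le fun k => (lintegral_compl_halfSpace_le_of_ne_top (hTm k) (hTeven k) (hTint k)
    v c hZ hZtop hZH).trans ?_
  exact lintegral_mono fun x => lintegral_mono fun y => hTle k (x - y)

end HalfSpace

/-- if `Z` is a bounded subset of a half-space `H` then
`I_s(Z, H∖Z) ≥ I_s(Z, ℝⁿ∖H)`. -/
theorem stmt10 (n : ℕ) (hn : 2 ≤ n) (s : ℝ) (hs : s ∈ Set.Ioo (0 : ℝ) 1)
    (H Z : Set (EuclideanSpace ℝ (Fin n))) (hH : IsOpenHalfSpace H)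
    (hZmeas : MeasurableSet Z) (hZbdd : Bornology.IsBounded Z) (hZH : Z ⊆ H) :
    interFrac n s Z Hᶜ ≤ interFrac n s Z (H \ Z) := by
  obtain ⟨v, -, c, rfl⟩ := hH
  exact lintegral_compl_halfSpace_le (K := fun z => ENNReal.ofReal (‖z‖ ^ (-((n : ℝ) + s))))
    (by fun_prop) (fun z => by rw [norm_neg]) v c hZmeas hZbdd.measure_lt_top.ne hZH
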